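/- Fix 1 ≤ a₀ ≤ n and j₀ ∈ ℤ_{≥1}. Let W be recorded by data ν^{(a)}_j supported in H_l, and define new data: W₁ increases ν^{(a₀)}_{j₀} by 2; W₂ increases ν^{(a₀)}_{j₀+1} and ν^{(a₀)}_{j₀−1} each by 1 (the factor with index j₀−1 = 0 being omitted when j₀ = 1); W₃ increases ν^{(b)}_{⌊(C_{b a₀} j₀ − k)/C_{a₀ b}⌋} by 1 for every b with C_{a₀ b} < 0 and every integer 0 ≤ k ≤ −C_{a₀ b} − 1 (indices equal to 0 omitted). Assume that all indices occurring in W₁, W₂, W₃ satisfy j ≤ t_a l, i.e. j₀ + 1 ≤ t_{a₀} l and ⌊(C_{b a₀} j₀ − k)/C_{a₀ b}⌋ ≤ t_b l for all relevant b, k. Then M_l(W₁,q) = M_l(W₂,q) + q^{−θ} M_l(W₃,q), where θ = j₀ + Σ_{k=1}^{t_{a₀} l} ν^{(a₀)}_k min(j₀,k). -/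

import Mathlib

open scoped BigOperators

namespace FermionicPaper

/-- The combinatorial data of a finite-dimensional simple Lie algebra `X_n` of type
`A_n, B_n, C_n, D_n, E_{6,7,8}, F_4, G_2`: the rank `n`, the numbers
`t_a = 2/(α_a|α_a) ∈ {1,2,3}` and the Cartan matrix `C_{ab} = t_a (α_a|α_b)`,
where `(·|·)` is the invariant bilinear form normalized by `(α|α) = 2` for long roots.
The axioms characterize exactly the Cartan data of the finite-dimensional simple Lie
algebras (symmetrizability, positive definiteness, connectedness, normalization). -/
structure CartanDatum (n : ℕ) : Type where
  t : Fin n → ℕ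
  C : Fin n → Fin n → ℤ
  t_pos : ∀ a, 0 < t a
  diag : ∀ a, C a a = 2
  offdiag_nonpos : ∀ a b, a ≠ b → C a b ≤ 0
  symm : ∀ a b, (t b : ℤ) * C a b = (t a : ℤ) * C b a
  posdef : ∀ v : Fin n → ℚ, v ≠ 0 → 0 < ∑ a, ∑ b, v a * ((C a b : ℚ) / (t a : ℚ)) * v b
  connected : ∀ S : Set (Fin n), S.Nonempty → (∀ a ∈ S, ∀ b, b ∉ S → C a b = 0) → ∀ a, a ∈ S
  normalized : ∃ a, t a = 1

variable {n : ℕ}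

/-- The invariant form `(α_a | α_b)`. -/
def CartanDatum.form (D : CartanDatum n) (a b : Fin n) : ℚ := (D.C a b : ℚ) / (D.t a : ℚ)

/-- `t = max_a t_a`. -/
def CartanDatum.tmax (D : CartanDatum n) : ℕ := Finset.univ.sup D.t

/-- The Cartan matrix as a rational matrix. -/
def CartanDatum.Cmat (D : CartanDatum n) : Matrix (Fin n) (Fin n) ℚ :=
  Matrix.of fun a b => (D.C a b : ℚ)

/-- The inverse Cartan matrix `C^{-1}`. -/
noncomputable def CartanDatum.Cinv (D : CartanDatum n) : Matrix (Fin n) (Fin n) ℚ := (D.Cmat)⁻¹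

/-- The invariant form on the weight space `P̄ ⊗ ℚ`, in the basis of fundamental weights;
`(Λ̄_a | Λ̄_b) = C^{-1}_{ab} / t_a`. -/
noncomputable def CartanDatum.wform (D : CartanDatum n) (μ ν : Fin n → ℚ) : ℚ :=
  ∑ a, ∑ b, μ a * (D.Cinv a b / (D.t a : ℚ)) * ν b

/-- The field `K = ℚ((q^{ℚ}))` of Hahn series in which all the `q`-series identities are stated. -/
abbrev K : Type := HahnSeries ℚ ℚ

/-- The monomial `q^c` for a rational exponent `c`. -/
noncomputable def hq (c : ℚ) : K := HahnSeries.single c 1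

/-- The extended `q`-binomial coefficient `{p+m choose m}` evaluated at `q^ε`
(`ε = 1` gives `q`, `ε = -1` gives `q^{-1}`); for `m ∈ ℤ_{≥0}` and integral `p` it equals
`(q^{p+1})_∞ (q^{m+1})_∞ / ((q)_∞ (q^{p+m+1})_∞) = ∏_{i=1}^m (1-q^{p+i})/(1-q^i)`. -/
noncomputable def qbinE (ε p : ℚ) (m : ℕ) : K :=
  ∏ i ∈ Finset.range m, (1 - hq (ε * (p + i + 1))) / (1 - hq (ε * (i + 1)))

/-- The truncated `q`-binomial coefficient `[p+m choose m]` at `q^ε`: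
it equals `{p+m choose m}` for `p ≥ 0` and `0` for `p < 0`. -/
noncomputable def qbinT (ε p : ℚ) (m : ℕ) : K := if 0 ≤ p then qbinE ε p m else 0

/-- `(q)_k = ∏_{j=1}^k (1 - q^j)`, at `q^ε`. -/
noncomputable def qpoch (ε : ℚ) (k : ℕ) : K := ∏ i ∈ Finset.range k, (1 - hq (ε * (i + 1)))

/-- `{p+m choose m}_1 = Γ(p+m+1)/(Γ(p+1)Γ(m+1)) = ∏_{i=1}^m (p+i)/i`, the `q = 1` value. -/
def bin1 (p : ℚ) (m : ℕ) : ℚ := ∏ i ∈ Finset.range m, (p + i + 1) / (i + 1)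

/-- A family `m^{(a)}_i` (or `ν^{(a)}_i`) has finitely many nonzero members. -/
def FinSupp (m : Fin n → ℕ → ℕ) : Prop :=
  (Function.support fun x : Fin n × ℕ => m x.1 x.2).Finite

variable (D : CartanDatum n)

/-- The vacancy numbers
`p^{(a)}_i = Σ_j ν^{(a)}_j min(i,j) − Σ_b (α_a|α_b) Σ_k min(t_b i, t_a k) m^{(b)}_k`. -/
noncomputable def pinf (ν m : Fin n → ℕ → ℕ) (a : Fin n) (i : ℕ) : ℚ :=
  (∑ᶠ j : ℕ, (ν a j : ℚ) * (min i j : ℕ))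
    - ∑ b, ∑ᶠ k : ℕ, D.form a b * (min (D.t b * i) (D.t a * k) : ℕ) * (m b k)

/-- The quadratic form
`c({m}) = ½ Σ_{a,b} (α_a|α_b) Σ_{j,k} min(t_b j, t_a k) m^{(a)}_j m^{(b)}_k
  − Σ_a Σ_{j,k} ν^{(a)}_j min(j,k) m^{(a)}_k` (allowing rational arguments `m`). -/
noncomputable def cinf (ν : Fin n → ℕ → ℕ) (m : Fin n → ℕ → ℚ) : ℚ :=
  (1/2) * (∑ a, ∑ b, ∑ᶠ j : ℕ, ∑ᶠ k : ℕ,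
      D.form a b * (min (D.t b * j) (D.t a * k) : ℕ) * m a j * m b k)
    - ∑ a, ∑ᶠ j : ℕ, ∑ᶠ k : ℕ, (ν a j : ℚ) * (min j k : ℕ) * m a k

/-- `c({m})` for integral `m`. -/
noncomputable def cinfN (ν m : Fin n → ℕ → ℕ) : ℚ := cinf D ν (fun a j => (m a j : ℚ))

/-- The constraint `Σ_{a,i} i m^{(a)}_i α_a = Σ_{a,i} i ν^{(a)}_i Λ̄_a − λ`, written in
the coordinates of the fundamental weight basis (`α_a = Σ_b C_{ba} Λ̄_b`). -/
def Constr (ν m : Fin n → ℕ → ℕ) (lam : Fin n → ℚ) : Prop :=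
  ∀ b, (∑ a, ∑ᶠ i : ℕ, (i : ℚ) * m a i * D.C b a) = (∑ᶠ i : ℕ, (i : ℚ) * ν b i) - lam b

/-- The admissible configurations for the fermionic form `M(W,λ,q)`. -/
def admM (ν : Fin n → ℕ → ℕ) (lam : Fin n → ℚ) : Set (Fin n → ℕ → ℕ) :=
  {m | FinSupp m ∧ Constr D ν m lam ∧ ∀ a, ∀ i : ℕ, 1 ≤ i → 0 ≤ pinf D ν m a i}

/-- The fermionic form `M(W,λ,q^ε)` for `W = ⊗_{a,j} (W^{(a)}_j)^{⊗ ν^{(a)}_j}` and `λ ∈ P̄`. -/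
noncomputable def M (ε : ℚ) (ν : Fin n → ℕ → ℕ) (lam : Fin n → ℚ) : K :=
  ∑ᶠ m ∈ admM D ν lam,
    hq (ε * cinfN D ν m) *
      ∏ᶠ a : Fin n, ∏ᶠ i ∈ {i : ℕ | 1 ≤ i}, qbinT ε (pinf D ν m a i) (m a i)

/-- Level-`l` restricted vacancy numbers (all indices restricted to `H_l`). -/
noncomputable def pl (l : ℕ) (ν m : Fin n → ℕ → ℕ) (a : Fin n) (i : ℕ) : ℚ :=
  (∑ j ∈ Finset.Icc 1 (D.t a * l), (ν a j : ℚ) * (min j i : ℕ))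
    - ∑ b, ∑ k ∈ Finset.Icc 1 (D.t b * l),
        D.form a b * (min (D.t b * i) (D.t a * k) : ℕ) * (m b k)

/-- Level-`l` restricted quadratic form `c_l({m})`. -/
noncomputable def cl (l : ℕ) (ν m : Fin n → ℕ → ℕ) : ℚ :=
  (1/2) * (∑ a, ∑ b, ∑ j ∈ Finset.Icc 1 (D.t a * l), ∑ k ∈ Finset.Icc 1 (D.t b * l),
      D.form a b * (min (D.t b * j) (D.t a * k) : ℕ) * (m a j) * (m b k))
    - ∑ a, ∑ j ∈ Finset.Icc 1 (D.t a * l), ∑ k ∈ Finset.Icc 1 (D.t a * l),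
        (ν a j : ℚ) * (min j k : ℕ) * (m a k)

/-- A family is supported in `H_l = {(a,j) | 1 ≤ j ≤ t_a l}`. -/
def SuppIn (l : ℕ) (m : Fin n → ℕ → ℕ) : Prop :=
  ∀ a j, m a j ≠ 0 → 1 ≤ j ∧ j ≤ D.t a * l

/-- Level-`l` constraint `Σ_{(a,i)∈H_l} i m^{(a)}_i α_a = Σ_{(a,i)∈H_l} i ν^{(a)}_i Λ̄_a − λ`. -/
def ConstrL (l : ℕ) (ν m : Fin n → ℕ → ℕ) (lam : Fin n → ℚ) : Prop :=
  ∀ b, (∑ a, ∑ i ∈ Finset.Icc 1 (D.t a * l), (i : ℚ) * m a i * D.C b a)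
      = (∑ i ∈ Finset.Icc 1 (D.t b * l), (i : ℚ) * ν b i) - lam b

/-- The level-`l` restricted fermionic form `M_l(W,q^ε)`. -/
noncomputable def Ml (ε : ℚ) (l : ℕ) (ν : Fin n → ℕ → ℕ) : K :=
  ∑ᶠ m ∈ {m | SuppIn D l m ∧ ConstrL D l ν m 0 ∧
      ∀ a, ∀ i ∈ Finset.Icc 1 (D.t a * l), 0 ≤ pl D l ν m a i},
    hq (ε * cl D l ν m) *
      ∏ a, ∏ i ∈ Finset.Icc 1 (D.t a * l), qbinT ε (pl D l ν m a i) (m a i)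

/-- The fermionic form `N_l(W,λ,q^ε)`: no positivity imposed on the vacancy numbers, and
extended `q`-binomial coefficients are used. -/
noncomputable def Nl (ε : ℚ) (l : ℕ) (ν : Fin n → ℕ → ℕ) (lam : Fin n → ℚ) : K :=
  ∑ᶠ m ∈ {m | SuppIn D l m ∧ ConstrL D l ν m lam},
    hq (ε * cl D l ν m) *
      ∏ a, ∏ i ∈ Finset.Icc 1 (D.t a * l), qbinE ε (pl D l ν m a i) (m a i)

/-- `N_∞(W,λ,q)` at `q = 1`. -/
noncomputable def Ninf1 (ν : Fin n → ℕ → ℕ) (lam : Fin n → ℚ) : ℚ :=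
  ∑ᶠ m ∈ {m | FinSupp m ∧ Constr D ν m lam},
    ∏ᶠ a : Fin n, ∏ᶠ i ∈ {i : ℕ | 1 ≤ i}, bin1 (pinf D ν m a i) (m a i)

/-- `N_l(W,λ,q)` at `q = 1`. -/
noncomputable def Nl1 (l : ℕ) (ν : Fin n → ℕ → ℕ) (lam : Fin n → ℚ) : ℚ :=
  ∑ᶠ m ∈ {m | SuppIn D l m ∧ ConstrL D l ν m lam},
    ∏ a, ∏ i ∈ Finset.Icc 1 (D.t a * l), bin1 (pl D l ν m a i) (m a i)

/-- The data of `W₁ = W^{(a₀)}_{j₀} ⊗ W^{(a₀)}_{j₀} ⊗ W`. -/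
def nu1 (ν : Fin n → ℕ → ℕ) (a₀ : Fin n) (j₀ : ℕ) : Fin n → ℕ → ℕ :=
  fun a j => ν a j + if a = a₀ ∧ j = j₀ then 2 else 0

/-- The data of `W₂ = W^{(a₀)}_{j₀+1} ⊗ W^{(a₀)}_{j₀−1} ⊗ W` (a factor with index `0`
being inert/omitted). -/
def nu2 (ν : Fin n → ℕ → ℕ) (a₀ : Fin n) (j₀ : ℕ) : Fin n → ℕ → ℕ :=
  fun a j => ν a j + (if a = a₀ ∧ j = j₀ + 1 then 1 else 0)
    + (if a = a₀ ∧ j = j₀ - 1 then 1 else 0)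

/-- The data of `W₃ = ⊗_{b ∼ a₀} ⊗_{k=0}^{-C_{a₀b}-1} W^{(b)}_{⌊(C_{b a₀} j₀ − k)/C_{a₀ b}⌋} ⊗ W`
(a factor with index `0` being inert/omitted); repeated indices are counted with
multiplicity. -/
def nu3 (ν : Fin n → ℕ → ℕ) (a₀ : Fin n) (j₀ : ℕ) : Fin n → ℕ → ℕ :=
  fun b j => ν b j +
    if D.C a₀ b < 0 then
      ((Finset.range (-(D.C a₀ b)).toNat).filter
        (fun k : ℕ => (((D.C b a₀) * (j₀ : ℤ) - (k : ℤ)).fdiv (D.C a₀ b)).toNat = j)).card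
    else 0


/-- The `ν`-part of the vacancy number. -/
noncomputable def PP (l : ℕ) (ν : Fin n → ℕ → ℕ) (a : Fin n) (i : ℕ) : ℚ :=
  ∑ j ∈ Finset.Icc 1 (D.t a * l), (ν a j : ℚ) * (min j i : ℕ)

/-- The kernel of the quadratic form. -/
noncomputable def GG (a b : Fin n) (j k : ℕ) : ℚ :=
  D.form a b * (min (D.t b * j) (D.t a * k) : ℕ)

/-- The `m`-part of the vacancy number. -/
noncomputable def LL (l : ℕ) (m : Fin n → ℕ → ℕ) (a : Fin n) (i : ℕ) : ℚ :=
  ∑ b, ∑ k ∈ Finset.Icc 1 (D.t b * l), GG D a b i k * (m b k)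

/-- Adding one string of length `j₀` and colour `a₀`. -/
def addOne (a₀ : Fin n) (j₀ : ℕ) (m : Fin n → ℕ → ℕ) : Fin n → ℕ → ℕ :=
  fun a j => m a j + if a = a₀ ∧ j = j₀ then 1 else 0

lemma pl_eq (l : ℕ) (ν m : Fin n → ℕ → ℕ) (a : Fin n) (i : ℕ) :
    pl D l ν m a i = PP D l ν a i - LL D l m a i := rfl

lemma cl_eq (l : ℕ) (ν m : Fin n → ℕ → ℕ) :
    cl D l ν m = (1/2) * (∑ a, ∑ j ∈ Finset.Icc 1 (D.t a * l), (m a j : ℚ) * LL D l m a j)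
      - ∑ a, ∑ k ∈ Finset.Icc 1 (D.t a * l), (m a k : ℚ) * PP D l ν a k := by
  unfold cl LL PP GG
  congr 1
  · congr 1
    refine Finset.sum_congr rfl fun a _ => ?_
    rw [Finset.sum_comm]
    refine Finset.sum_congr rfl fun j _ => ?_
    rw [Finset.mul_sum]
    refine Finset.sum_congr rfl fun b _ => ?_
    rw [Finset.mul_sum]
    refine Finset.sum_congr rfl fun k _ => ?_
    ring
  · refine Finset.sum_congr rfl fun a _ => ?_
    rw [Finset.sum_comm]
    refine Finset.sum_congr rfl fun j _ => ?_
    rw [Finset.mul_sum]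
    refine Finset.sum_congr rfl fun k _ => ?_
    ring

lemma tq_ne (a : Fin n) : (D.t a : ℚ) ≠ 0 := by
  have := D.t_pos a
  positivity

lemma form_symm (a b : Fin n) : D.form a b = D.form b a := by
  unfold CartanDatum.form
  rw [div_eq_div_iff (tq_ne D a) (tq_ne D b)]
  have := D.symm a b
  have h : ((D.t b : ℤ) * D.C a b : ℚ) = ((D.t a : ℤ) * D.C b a : ℚ) := by exact_mod_cast this
  push_cast at h
  linarith

lemma GG_symm (a b : Fin n) (j k : ℕ) : GG D a b j k = GG D b a k j := by
  unfold GG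
  rw [form_symm D a b, min_comm]

lemma GG_self (a : Fin n) (j k : ℕ) : GG D a a j k = 2 * (min j k : ℕ) := by
  unfold GG CartanDatum.form
  rw [D.diag, Nat.mul_min_mul_left]
  have := tq_ne D a
  push_cast
  field_simp

lemma GG_int (a b : Fin n) (j k : ℕ) : ∃ z : ℤ, GG D a b j k = z := by
  rcases min_choice (D.t b * j) (D.t a * k) with h | h
  · refine ⟨D.C b a * j, ?_⟩
    unfold GG
    rw [h, form_symm]
    unfold CartanDatum.form
    have := tq_ne D b
    push_cast
    field_simp
  · refine ⟨D.C a b * k, ?_⟩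
    unfold GG
    rw [h]
    unfold CartanDatum.form
    have := tq_ne D a
    push_cast
    field_simp

lemma pl_int (l : ℕ) (ν m : Fin n → ℕ → ℕ) (a : Fin n) (i : ℕ) :
    ∃ z : ℤ, pl D l ν m a i = z := by
  choose g hg using GG_int D
  refine ⟨(∑ j ∈ Finset.Icc 1 (D.t a * l), (ν a j : ℤ) * (min j i : ℕ))
    - ∑ b, ∑ k ∈ Finset.Icc 1 (D.t b * l), g a b i k * (m b k), ?_⟩
  rw [pl_eq]
  unfold PP LL
  simp only [hg]
  push_cast
  rfl

/-- Summing against an indicator. -/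
lemma sum_delta (l : ℕ) (a₀ : Fin n) (j₀ : ℕ) (h1 : 1 ≤ j₀) (h2 : j₀ ≤ D.t a₀ * l)
    (f : Fin n → ℕ → ℚ) :
    ∑ a, ∑ j ∈ Finset.Icc 1 (D.t a * l), (if a = a₀ ∧ j = j₀ then f a j else 0) = f a₀ j₀ := by
  rw [Finset.sum_eq_single a₀]
  · rw [Finset.sum_eq_single j₀]
    · simp
    · intro j _ hj; simp [hj]
    · intro h; exact absurd (Finset.mem_Icc.2 ⟨h1, h2⟩) h
  · intro a _ ha
    simp [ha]
  · simp

lemma LL_addOne (l : ℕ) (a₀ : Fin n) (j₀ : ℕ) (h1 : 1 ≤ j₀) (h2 : j₀ ≤ D.t a₀ * l)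
    (m : Fin n → ℕ → ℕ) (a : Fin n) (i : ℕ) :
    LL D l (addOne a₀ j₀ m) a i = LL D l m a i + GG D a a₀ i j₀ := by
  unfold LL addOne
  rw [← sum_delta D l a₀ j₀ h1 h2 (fun b k => GG D a b i k), ← Finset.sum_add_distrib]
  refine Finset.sum_congr rfl fun b _ => ?_
  rw [← Finset.sum_add_distrib]
  refine Finset.sum_congr rfl fun k _ => ?_
  push_cast
  split_ifs <;> ring

lemma sum_addOne (l : ℕ) (a₀ : Fin n) (j₀ : ℕ) (h1 : 1 ≤ j₀) (h2 : j₀ ≤ D.t a₀ * l)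
    (m : Fin n → ℕ → ℕ) (f : Fin n → ℕ → ℚ) :
    ∑ a, ∑ j ∈ Finset.Icc 1 (D.t a * l), (addOne a₀ j₀ m a j : ℚ) * f a j
     = (∑ a, ∑ j ∈ Finset.Icc 1 (D.t a * l), (m a j : ℚ) * f a j) + f a₀ j₀ := by
  unfold addOne
  rw [← sum_delta D l a₀ j₀ h1 h2 f, ← Finset.sum_add_distrib]
  refine Finset.sum_congr rfl fun b _ => ?_
  rw [← Finset.sum_add_distrib]
  refine Finset.sum_congr rfl fun k _ => ?_
  push_cast
  split_ifs <;> ring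

lemma PP_nu1 (l : ℕ) (ν : Fin n → ℕ → ℕ) (a₀ : Fin n) (j₀ : ℕ) (h1 : 1 ≤ j₀)
    (h2 : j₀ ≤ D.t a₀ * l) (a : Fin n) (i : ℕ) :
    PP D l (nu1 ν a₀ j₀) a i = PP D l ν a i + if a = a₀ then 2 * ((min j₀ i : ℕ) : ℚ) else 0 := by
  unfold PP nu1
  by_cases ha : a = a₀
  · subst ha
    have : ∀ j, ((ν a j + if a = a ∧ j = j₀ then 2 else 0 : ℕ) : ℚ) * (min j i : ℕ)
        = (ν a j : ℚ) * (min j i : ℕ) + (if j = j₀ then 2 * ((min j i : ℕ) : ℚ) else 0) := by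
      intro j
      by_cases h : j = j₀
      · simp [h]; ring
      · simp [h]
    rw [Finset.sum_congr rfl fun j _ => this j]
    simp only [Finset.sum_add_distrib, Finset.sum_ite_eq', Finset.mem_Icc, h1, h2, and_self,
      if_true]
  · simp [ha]

lemma PP_nu2 (l : ℕ) (ν : Fin n → ℕ → ℕ) (a₀ : Fin n) (j₀ : ℕ) (h1 : 1 ≤ j₀)
    (h2 : j₀ + 1 ≤ D.t a₀ * l) (a : Fin n) (i : ℕ) :
    PP D l (nu2 ν a₀ j₀) a i
      = PP D l (nu1 ν a₀ j₀) a i - if a = a₀ ∧ i = j₀ then 1 else 0 := by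
  rw [PP_nu1 D l ν a₀ j₀ h1 (by omega)]
  unfold PP nu2
  by_cases ha : a = a₀
  · subst ha
    have : ∀ j, ((ν a j + (if a = a ∧ j = j₀ + 1 then 1 else 0)
        + (if a = a ∧ j = j₀ - 1 then 1 else 0) : ℕ) : ℚ) * (min j i : ℕ)
        = (ν a j : ℚ) * (min j i : ℕ) + (if j = j₀ + 1 then ((min j i : ℕ) : ℚ) else 0)
          + (if j = j₀ - 1 then ((min j i : ℕ) : ℚ) else 0) := by
      intro j
      push_cast
      simp only [true_and]
      split_ifs <;> ring
    rw [Finset.sum_congr rfl fun j _ => this j]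
    simp only [Finset.sum_add_distrib, Finset.sum_ite_eq', Finset.mem_Icc, h2,
      show 1 ≤ j₀ + 1 by omega, if_true, true_and]
    have e : (if 1 ≤ j₀ - 1 ∧ j₀ - 1 ≤ D.t a * l then ((min (j₀ - 1) i : ℕ) : ℚ) else 0)
        = ((min (j₀ - 1) i : ℕ) : ℚ) := by
      split_ifs with h
      · rfl
      · have : j₀ - 1 = 0 := by omega
        simp [this]
    rw [e]
    by_cases hi : i = j₀
    · rw [if_pos hi]
      have : min (j₀ + 1) i + min (j₀ - 1) i + 1 = 2 * min j₀ i := by omega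
      have : ((min (j₀ + 1) i : ℕ) : ℚ) + (min (j₀ - 1) i : ℕ) + 1 = 2 * (min j₀ i : ℕ) := by
        exact_mod_cast this
      linarith
    · rw [if_neg hi]
      have : min (j₀ + 1) i + min (j₀ - 1) i = 2 * min j₀ i := by omega
      have : ((min (j₀ + 1) i : ℕ) : ℚ) + (min (j₀ - 1) i : ℕ) = 2 * (min j₀ i : ℕ) := by
        exact_mod_cast this
      linarith
  · simp [ha]

/-- Hermite-type identity. -/
lemma hermite_gen (g : ℕ → ℕ) (s N : ℕ) (hs : 0 < s) :
    ∑ k ∈ Finset.range s, g ((N + 1 + k) / s) + g (N / s)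
      = ∑ k ∈ Finset.range s, g ((N + k) / s) + g (N / s + 1) := by
  have h1 := Finset.sum_range_succ (fun k => g ((N + k) / s)) s
  have h2 := Finset.sum_range_succ' (fun k => g ((N + k) / s)) s
  have h3 : (N + s) / s = N / s + 1 := Nat.add_div_right N hs
  simp only [h3, add_zero] at h1 h2
  rw [← h1, h2]
  congr 1
  refine Finset.sum_congr rfl fun k _ => ?_
  congr 2
  ring

lemma hermite_min (s i N : ℕ) (hs : 0 < s) :
    ∑ k ∈ Finset.range s, min ((N + k) / s) i = min (s * i) N := by
  induction N with
  | zero =>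
    simp only [zero_add, Nat.min_zero]
    refine Finset.sum_eq_zero fun k hk => ?_
    rw [Nat.div_eq_of_lt (Finset.mem_range.1 hk)]
    simp
  | succ N ih =>
    have := hermite_gen (fun x => min x i) s N hs
    simp only [ih] at this
    by_cases h : N < s * i
    · have : N / s < i := by rw [Nat.div_lt_iff_lt_mul hs]; linarith
      omega
    · have : i ≤ N / s := by rw [Nat.le_div_iff_mul_le hs]; linarith
      omega

lemma hermite_id (s N : ℕ) (hs : 0 < s) :
    ∑ k ∈ Finset.range s, ((N + k) / s) = N := by
  induction N with
  | zero =>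
    refine Finset.sum_eq_zero fun k hk => ?_
    rw [zero_add, Nat.div_eq_of_lt (Finset.mem_range.1 hk)]
  | succ N ih =>
    have := hermite_gen (fun x => x) s N hs
    simp only [ih] at this
    omega

lemma idx_eq (r s j₀ k : ℕ) :
    (((-(r : ℤ)) * (j₀ : ℤ) - (k : ℤ)).fdiv (-(s : ℤ))).toNat = (r * j₀ + k) / s := by
  have : (-(r : ℤ)) * (j₀ : ℤ) - (k : ℤ) = -((r * j₀ + k : ℕ) : ℤ) := by push_cast; ring
  rw [this, Int.neg_fdiv_neg, Int.fdiv_eq_ediv_of_nonneg _ (by positivity), ← Int.natCast_ediv,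
    Int.toNat_natCast]

lemma sum_card (L : ℕ) (R : Finset ℕ) (x : ℕ → ℕ) (hx : ∀ k ∈ R, x k ≤ L) (f : ℕ → ℚ)
    (hf : f 0 = 0) :
    ∑ j ∈ Finset.Icc 1 L, (((R.filter (fun k => x k = j)).card : ℕ) : ℚ) * f j
      = ∑ k ∈ R, f (x k) := by
  have : ∀ j, (((R.filter (fun k => x k = j)).card : ℕ) : ℚ) * f j
      = ∑ k ∈ R, if x k = j then f j else 0 := by
    intro j
    rw [Finset.card_filter]
    push_cast
    rw [Finset.sum_mul]
    refine Finset.sum_congr rfl fun k _ => ?_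
    split_ifs <;> ring
  simp only [this]
  rw [Finset.sum_comm]
  refine Finset.sum_congr rfl fun k hk => ?_
  rw [Finset.sum_ite_eq]
  split_ifs with h
  · rfl
  · have h2 := hx k hk
    have : x k = 0 := by
      simp only [Finset.mem_Icc] at h
      omega
    rw [this, hf]

lemma C_neg_data (a₀ b : Fin n) (hC : D.C a₀ b < 0) :
    ∃ r s : ℕ, 0 < s ∧ D.C a₀ b = -(s : ℤ) ∧ D.C b a₀ = -(r : ℤ) ∧ D.t b * s = D.t a₀ * r := by
  have hne : a₀ ≠ b := by
    rintro rfl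
    rw [D.diag] at hC
    omega
  have h2 := D.offdiag_nonpos b a₀ hne.symm
  refine ⟨(-(D.C b a₀)).toNat, (-(D.C a₀ b)).toNat, by omega, by omega, by omega, ?_⟩
  have h := D.symm a₀ b
  zify
  rw [Int.toNat_of_nonneg (by omega), Int.toNat_of_nonneg (by omega)]
  linarith

lemma C_zero (a₀ b : Fin n) (hne : b ≠ a₀) (hC : ¬ D.C a₀ b < 0) : D.C b a₀ = 0 := by
  have h1 := D.offdiag_nonpos a₀ b hne.symm
  have h0 : D.C a₀ b = 0 := by omega
  have h := D.symm a₀ b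
  rw [h0] at h
  have := D.t_pos a₀
  have h3 : (D.t a₀ : ℤ) ≠ 0 := by omega
  rw [mul_zero] at h
  exact (mul_eq_zero.1 h.symm).resolve_left h3

/-- Sums of functions against the data of `W₃`. -/
lemma sum_nu3 (l : ℕ) (ν : Fin n → ℕ → ℕ) (a₀ : Fin n) (j₀ : ℕ)
    (hb₃ : ∀ b : Fin n, D.C a₀ b < 0 → ∀ k : ℕ, (k : ℤ) < -(D.C a₀ b) →
      ((((D.C b a₀) * (j₀ : ℤ) - (k : ℤ)).fdiv (D.C a₀ b)).toNat) ≤ D.t b * l)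
    (b : Fin n) (r s : ℕ) (hs : 0 < s) (h1 : D.C a₀ b = -(s : ℤ)) (h2 : D.C b a₀ = -(r : ℤ))
    (f : ℕ → ℚ) (hf : f 0 = 0) :
    ∑ j ∈ Finset.Icc 1 (D.t b * l), (nu3 D ν a₀ j₀ b j : ℚ) * f j
      = (∑ j ∈ Finset.Icc 1 (D.t b * l), (ν b j : ℚ) * f j)
        + ∑ k ∈ Finset.range s, f ((r * j₀ + k) / s) := by
  have hC : D.C a₀ b < 0 := by omega
  have hb := hb₃ b hC
  unfold nu3
  simp only [hC, if_true]
  simp only [h1, h2, idx_eq, neg_neg, Int.toNat_natCast] at hb ⊢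
  rw [← sum_card (D.t b * l) (Finset.range s) (fun k => (r * j₀ + k) / s)
    (fun k hk => hb k (by exact_mod_cast Finset.mem_range.1 hk)) f hf, ← Finset.sum_add_distrib]
  refine Finset.sum_congr rfl fun j _ => ?_
  push_cast
  ring

lemma PP_nu3 (l : ℕ) (ν : Fin n → ℕ → ℕ) (a₀ : Fin n) (j₀ : ℕ) (hj : 1 ≤ j₀)
    (hj2 : j₀ ≤ D.t a₀ * l)
    (hb₃ : ∀ b : Fin n, D.C a₀ b < 0 → ∀ k : ℕ, (k : ℤ) < -(D.C a₀ b) →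
      ((((D.C b a₀) * (j₀ : ℤ) - (k : ℤ)).fdiv (D.C a₀ b)).toNat) ≤ D.t b * l)
    (b : Fin n) (i : ℕ) :
    PP D l (nu1 ν a₀ j₀) b i = PP D l (nu3 D ν a₀ j₀) b i + GG D b a₀ i j₀ := by
  rw [PP_nu1 D l ν a₀ j₀ hj hj2]
  by_cases hb : b = a₀
  · subst hb
    rw [GG_self, if_pos rfl, min_comm]
    congr 1
    unfold PP nu3
    simp [D.diag]
  · rw [if_neg hb]
    by_cases hC : D.C a₀ b < 0
    · obtain ⟨r, s, hs, h1, h2, h3⟩ := C_neg_data D a₀ b hC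
      unfold PP
      rw [sum_nu3 D l ν a₀ j₀ hb₃ b r s hs h1 h2 (fun j => ((min j i : ℕ) : ℚ)) (by simp)]
      have hh := hermite_min s i (r * j₀) hs
      have hh2 : ∑ k ∈ Finset.range s, ((min ((r * j₀ + k) / s) i : ℕ) : ℚ)
        = ((min (s * i) (r * j₀) : ℕ) : ℚ) := by exact_mod_cast hh
      rw [hh2]
      have hG : (D.t b : ℚ) * GG D b a₀ i j₀ = - ((D.t b : ℚ) * ((min (s * i) (r * j₀) : ℕ) : ℚ)) := by
        unfold GG CartanDatum.form
        rw [h2]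
        have e : r * min (D.t a₀ * i) (D.t b * j₀) = D.t b * min (s * i) (r * j₀) := by
          rw [← Nat.mul_min_mul_left, ← Nat.mul_min_mul_left, ← mul_assoc (D.t b) s i, h3]
          congr 1 <;> ring
        have e2 : (r : ℚ) * ((min (D.t a₀ * i) (D.t b * j₀) : ℕ) : ℚ)
          = (D.t b : ℚ) * ((min (s * i) (r * j₀) : ℕ) : ℚ) := by exact_mod_cast e
        rw [← e2]
        have := tq_ne D b
        push_cast
        field_simp
      have hG2 : GG D b a₀ i j₀ = - ((min (s * i) (r * j₀) : ℕ) : ℚ) := by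
        apply mul_left_cancel₀ (tq_ne D b)
        rw [hG]; ring
      rw [hG2]
      ring
    · have h0 := C_zero D a₀ b hb hC
      unfold PP nu3 GG CartanDatum.form
      simp [hC, h0]

lemma wt_nu3 (l : ℕ) (ν : Fin n → ℕ → ℕ) (a₀ : Fin n) (j₀ : ℕ) (hj : 1 ≤ j₀)
    (hj2 : j₀ ≤ D.t a₀ * l)
    (hb₃ : ∀ b : Fin n, D.C a₀ b < 0 → ∀ k : ℕ, (k : ℤ) < -(D.C a₀ b) →
      ((((D.C b a₀) * (j₀ : ℤ) - (k : ℤ)).fdiv (D.C a₀ b)).toNat) ≤ D.t b * l)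
    (b : Fin n) :
    (∑ i ∈ Finset.Icc 1 (D.t b * l), (i : ℚ) * nu1 ν a₀ j₀ b i)
      = (∑ i ∈ Finset.Icc 1 (D.t b * l), (i : ℚ) * nu3 D ν a₀ j₀ b i) + j₀ * D.C b a₀ := by
  by_cases hb : b = a₀
  · subst hb
    unfold nu1 nu3
    have : ∀ j : ℕ, (j : ℚ) * ((ν b j + if b = b ∧ j = j₀ then 2 else 0 : ℕ) : ℚ)
        = (j : ℚ) * ν b j + (if j = j₀ then 2 * (j : ℚ) else 0) := by
      intro j
      push_cast
      simp only [true_and]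
      split_ifs <;> ring
    rw [Finset.sum_congr rfl fun j _ => this j]
    simp only [Finset.sum_add_distrib, Finset.sum_ite_eq', Finset.mem_Icc, hj, hj2, and_self,
      if_true, D.diag]
    simp [mul_comm]
  · by_cases hC : D.C a₀ b < 0
    · obtain ⟨r, s, hs, h1, h2, h3⟩ := C_neg_data D a₀ b hC
      have := sum_nu3 D l ν a₀ j₀ hb₃ b r s hs h1 h2 (fun j => (j : ℚ)) (by simp)
      have hh := hermite_id s (r * j₀) hs
      have hh2 : ∑ k ∈ Finset.range s, (((r * j₀ + k) / s : ℕ) : ℚ) = r * j₀ := by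
        exact_mod_cast hh
      rw [hh2] at this
      have e : ∀ f : Fin n → ℕ → ℕ, (∑ i ∈ Finset.Icc 1 (D.t b * l), (i : ℚ) * f b i)
        = ∑ i ∈ Finset.Icc 1 (D.t b * l), (f b i : ℚ) * i := fun f =>
          Finset.sum_congr rfl fun i _ => mul_comm _ _
      rw [e, e, this, h2]
      unfold nu1
      simp only [hb, false_and, if_false, add_zero]
      push_cast
      ring
    · have h0 := C_zero D a₀ b hb hC
      unfold nu1 nu3
      simp [hC, h0, hb]

lemma wt_nu2 (l : ℕ) (ν : Fin n → ℕ → ℕ) (a₀ : Fin n) (j₀ : ℕ) (h1 : 1 ≤ j₀)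
    (h2 : j₀ + 1 ≤ D.t a₀ * l) (b : Fin n) :
    (∑ i ∈ Finset.Icc 1 (D.t b * l), (i : ℚ) * nu2 ν a₀ j₀ b i)
      = ∑ i ∈ Finset.Icc 1 (D.t b * l), (i : ℚ) * nu1 ν a₀ j₀ b i := by
  -- obtained from the vacancy numbers at a large index
  have e : ∀ f : Fin n → ℕ → ℕ, (∑ i ∈ Finset.Icc 1 (D.t b * l), (i : ℚ) * f b i)
      = PP D l f b (D.t b * l + j₀ + 1) := by
    intro f
    unfold PP
    refine Finset.sum_congr rfl fun i hi => ?_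
    rw [Finset.mem_Icc] at hi
    rw [min_eq_left (by omega), mul_comm]
  rw [e, e, PP_nu2 D l ν a₀ j₀ h1 h2, if_neg (by omega), sub_zero]

lemma cl_addOne (l : ℕ) (ν : Fin n → ℕ → ℕ) (a₀ : Fin n) (j₀ : ℕ) (hj : 1 ≤ j₀)
    (hj2 : j₀ ≤ D.t a₀ * l)
    (hb₃ : ∀ b : Fin n, D.C a₀ b < 0 → ∀ k : ℕ, (k : ℤ) < -(D.C a₀ b) →
      ((((D.C b a₀) * (j₀ : ℤ) - (k : ℤ)).fdiv (D.C a₀ b)).toNat) ≤ D.t b * l)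
    (m : Fin n → ℕ → ℕ) :
    cl D l (nu1 ν a₀ j₀) (addOne a₀ j₀ m)
      = -((j₀ + ∑ k ∈ Finset.Icc 1 (D.t a₀ * l), ν a₀ k * min j₀ k : ℕ) : ℚ)
        + cl D l (nu3 D ν a₀ j₀) m := by
  rw [cl_eq, cl_eq, sum_addOne D l a₀ j₀ hj hj2, sum_addOne D l a₀ j₀ hj hj2]
  have hL : LL D l m a₀ j₀
      = ∑ a, ∑ j ∈ Finset.Icc 1 (D.t a * l), (m a j : ℚ) * GG D a a₀ j j₀ := by
    unfold LL
    refine Finset.sum_congr rfl fun b _ => Finset.sum_congr rfl fun k _ => ?_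
    rw [GG_symm, mul_comm]
  have hP : PP D l (nu1 ν a₀ j₀) a₀ j₀
      = ((∑ k ∈ Finset.Icc 1 (D.t a₀ * l), ν a₀ k * min j₀ k : ℕ) : ℚ) + 2 * j₀ := by
    rw [PP_nu1 D l ν a₀ j₀ hj hj2, if_pos rfl, min_self]
    unfold PP
    push_cast
    congr 1
    refine Finset.sum_congr rfl fun k _ => ?_
    rw [min_comm]
  rw [hP]
  simp only [LL_addOne D l a₀ j₀ hj hj2, PP_nu3 D l ν a₀ j₀ hj hj2 hb₃, mul_add,
    Finset.sum_add_distrib, GG_self, min_self]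
  rw [hL]
  push_cast
  ring

lemma cl_nu2 (l : ℕ) (ν : Fin n → ℕ → ℕ) (a₀ : Fin n) (j₀ : ℕ) (h1 : 1 ≤ j₀)
    (h2 : j₀ + 1 ≤ D.t a₀ * l) (m : Fin n → ℕ → ℕ) :
    cl D l (nu2 ν a₀ j₀) m = cl D l (nu1 ν a₀ j₀) m + m a₀ j₀ := by
  rw [cl_eq, cl_eq]
  have : ∑ a, ∑ k ∈ Finset.Icc 1 (D.t a * l), (m a k : ℚ) * PP D l (nu2 ν a₀ j₀) a k
      = (∑ a, ∑ k ∈ Finset.Icc 1 (D.t a * l), (m a k : ℚ) * PP D l (nu1 ν a₀ j₀) a k)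
        - m a₀ j₀ := by
    rw [← sum_delta D l a₀ j₀ h1 (by omega) (fun a k => (m a k : ℚ)), ← Finset.sum_sub_distrib]
    refine Finset.sum_congr rfl fun b _ => ?_
    rw [← Finset.sum_sub_distrib]
    refine Finset.sum_congr rfl fun k _ => ?_
    rw [PP_nu2 D l ν a₀ j₀ h1 h2]
    split_ifs <;> ring
  rw [this]
  ring

lemma min_concave (s c i : ℕ) (hi : 1 ≤ i) :
    ((min (s * (i + 1)) c : ℕ) : ℚ) + (min (s * (i - 1)) c : ℕ) ≤ 2 * (min (s * i) c : ℕ) := by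
  obtain ⟨i, rfl⟩ : ∃ x, i = x + 1 := ⟨i - 1, by omega⟩
  have : min (s * (i + 1 + 1)) c + min (s * (i + 1 - 1)) c ≤ 2 * min (s * (i + 1)) c := by
    rw [Nat.add_sub_cancel, mul_add, mul_add]
    omega
  exact_mod_cast this

lemma PP_concave (l : ℕ) (ν : Fin n → ℕ → ℕ) (a : Fin n) (i : ℕ) (hi : 1 ≤ i) :
    PP D l ν a (i + 1) + PP D l ν a (i - 1) ≤ 2 * PP D l ν a i := by
  unfold PP
  rw [Finset.mul_sum, ← Finset.sum_add_distrib]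
  refine Finset.sum_le_sum fun j _ => ?_
  have h := min_concave 1 j i hi
  simp only [one_mul] at h
  rw [min_comm j, min_comm j, min_comm j, ← mul_add, mul_left_comm]
  exact mul_le_mul_of_nonneg_left h (by positivity)

lemma LL_convex (l : ℕ) (m : Fin n → ℕ → ℕ) (a : Fin n) (i : ℕ) (hi : 1 ≤ i) (hm : m a i = 0) :
    2 * LL D l m a i ≤ LL D l m a (i + 1) + LL D l m a (i - 1) := by
  unfold LL
  rw [Finset.mul_sum, ← Finset.sum_add_distrib]
  refine Finset.sum_le_sum fun b _ => ?_
  rw [Finset.mul_sum, ← Finset.sum_add_distrib]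
  refine Finset.sum_le_sum fun k _ => ?_
  by_cases hb : b = a
  · subst hb
    by_cases hk : k = i
    · subst hk
      simp [hm]
    · rw [GG_self, GG_self, GG_self]
      have : 2 * min i k = min (i + 1) k + min (i - 1) k := by omega
      have : 2 * ((min i k : ℕ) : ℚ) = (min (i + 1) k : ℕ) + (min (i - 1) k : ℕ) := by
        exact_mod_cast this
      rw [← mul_assoc, this]
      apply le_of_eq
      ring
  · have hf : D.form a b ≤ 0 := by
      unfold CartanDatum.form
      have := D.offdiag_nonpos a b (Ne.symm hb)
      have h2 : (D.C a b : ℚ) ≤ 0 := by exact_mod_cast this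
      exact div_nonpos_of_nonpos_of_nonneg h2 (by positivity)
    have h := mul_le_mul_of_nonpos_left (min_concave (D.t b) (D.t a * k) i hi) hf
    have h' := mul_le_mul_of_nonneg_right h (Nat.cast_nonneg (α := ℚ) (m b k))
    unfold GG
    linarith

lemma pl_zero (l : ℕ) (ν m : Fin n → ℕ → ℕ) (a : Fin n) : pl D l ν m a 0 = 0 := by
  simp [pl]

/-- If `m^{(a₀)}_{j₀} = 0` then the vacancy number for `W₁` at `(a₀,j₀)` is positive. -/
lemma vac_pos (l : ℕ) (ν : Fin n → ℕ → ℕ) (a₀ : Fin n) (j₀ : ℕ) (h1 : 1 ≤ j₀)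
    (h2 : j₀ + 1 ≤ D.t a₀ * l) (m : Fin n → ℕ → ℕ)
    (hp : ∀ a, ∀ i ∈ Finset.Icc 1 (D.t a * l), 0 ≤ pl D l (nu1 ν a₀ j₀) m a i)
    (hm : m a₀ j₀ = 0) : 0 < pl D l (nu1 ν a₀ j₀) m a₀ j₀ := by
  have hA : 0 ≤ pl D l (nu1 ν a₀ j₀) m a₀ (j₀ + 1) :=
    hp a₀ _ (Finset.mem_Icc.2 ⟨by omega, h2⟩)
  have hB : 0 ≤ pl D l (nu1 ν a₀ j₀) m a₀ (j₀ - 1) := by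
    by_cases h : j₀ - 1 = 0
    · rw [h, pl_zero]
    · exact hp a₀ _ (Finset.mem_Icc.2 ⟨by omega, by omega⟩)
  have hL := LL_convex D l m a₀ j₀ h1 hm
  have hP := PP_concave D l ν a₀ j₀ h1
  rw [pl_eq, PP_nu1 D l ν a₀ j₀ h1 (by omega), if_pos rfl] at hA hB ⊢
  have e1 : min j₀ (j₀ + 1) = j₀ := by omega
  have e2 : min j₀ (j₀ - 1) + 1 = j₀ := by omega
  have e2' : ((min j₀ (j₀ - 1) : ℕ) : ℚ) + 1 = j₀ := by exact_mod_cast e2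
  rw [e1] at hA
  rw [min_self]
  linarith

/-- The admissible configurations of `Ml`. -/
def AA (l : ℕ) (ν : Fin n → ℕ → ℕ) : Set (Fin n → ℕ → ℕ) :=
  {m | SuppIn D l m ∧ ConstrL D l ν m 0 ∧
      ∀ a, ∀ i ∈ Finset.Icc 1 (D.t a * l), 0 ≤ pl D l ν m a i}

/-- The summand of `Ml`. -/
noncomputable def TT (l : ℕ) (ν m : Fin n → ℕ → ℕ) : K :=
  hq (cl D l ν m) * ∏ a, ∏ i ∈ Finset.Icc 1 (D.t a * l), qbinT 1 (pl D l ν m a i) (m a i)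

lemma Ml_eq (l : ℕ) (ν : Fin n → ℕ → ℕ) : Ml D 1 l ν = ∑ᶠ m ∈ AA D l ν, TT D l ν m := by
  unfold Ml AA TT
  simp only [one_mul]

lemma C_inj (v : Fin n → ℚ) (h : ∀ b, ∑ a, v a * D.C b a = 0) : v = 0 := by
  by_contra hv
  have h1 := D.posdef v hv
  have h2 : ∑ a, ∑ b, v a * ((D.C a b : ℚ) / (D.t a : ℚ)) * v b = 0 := by
    refine Finset.sum_eq_zero fun a _ => ?_
    have : ∑ b, v a * ((D.C a b : ℚ) / (D.t a : ℚ)) * v b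
        = (v a / D.t a) * ∑ b, v b * D.C a b := by
      rw [Finset.mul_sum]
      refine Finset.sum_congr rfl fun b _ => ?_
      ring
    rw [this, h, mul_zero]
  linarith

lemma AA_finite (l : ℕ) (ν : Fin n → ℕ → ℕ) : (AA D l ν).Finite := by
  rcases (AA D l ν).eq_empty_or_nonempty with h | ⟨m0, hm0⟩
  · rw [h]; exact Set.finite_empty
  let X : (Fin n → ℕ → ℕ) → Fin n → ℕ := fun m a => ∑ i ∈ Finset.Icc 1 (D.t a * l), i * m a i
  have hX : ∀ m ∈ AA D l ν, ∀ a, X m a = X m0 a := by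
    intro m hm
    have key := C_inj D (fun a => (X m a : ℚ) - X m0 a) (by
      intro b
      have c1 := hm.2.1 b
      have c2 := hm0.2.1 b
      rw [← c2] at c1
      have e : ∀ m : Fin n → ℕ → ℕ,
          (∑ a, ∑ i ∈ Finset.Icc 1 (D.t a * l), (i : ℚ) * m a i * D.C b a)
            = ∑ a, (X m a : ℚ) * D.C b a := by
        intro m
        refine Finset.sum_congr rfl fun a _ => ?_
        simp only [X]
        push_cast
        rw [Finset.sum_mul]
      rw [e, e] at c1
      simp only [sub_mul, Finset.sum_sub_distrib]
      linarith)
    intro a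
    have := congrFun key a
    simp only [Pi.zero_apply, sub_eq_zero] at this
    exact_mod_cast this
  let T : ℕ := ∑ a, D.t a * l
  have hT : ∀ a, D.t a * l ≤ T := fun a =>
    Finset.single_le_sum (f := fun a => D.t a * l) (fun _ _ => Nat.zero_le _) (Finset.mem_univ a)
  refine Set.Finite.of_finite_image
    (f := fun (m : Fin n → ℕ → ℕ) (a : Fin n) (i : Fin (T + 1)) => m a i) ?_ ?_
  · refine (Set.finite_Icc (0 : Fin n → Fin (T + 1) → ℕ) (fun a _ => X m0 a)).subset ?_
    rintro _ ⟨m, hm, rfl⟩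
    refine ⟨fun _ _ => Nat.zero_le _, fun a i => ?_⟩
    show m a i ≤ X m0 a
    by_cases h0 : m a i = 0
    · omega
    · have hs := hm.1 a i h0
      rw [← hX m hm a]
      calc m a i ≤ i * m a i := Nat.le_mul_of_pos_left _ hs.1
        _ ≤ X m a := Finset.single_le_sum (f := fun i => i * m a i) (fun _ _ => Nat.zero_le _)
            (Finset.mem_Icc.2 hs)
  · intro m hm m' hm' he
    funext a i
    by_cases hi : i < T + 1
    · exact congrFun (congrFun he a) ⟨i, hi⟩
    · have h1 : m a i = 0 := by
        by_contra h
        have := (hm.1 a i h).2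
        have := hT a
        omega
      have h2 : m' a i = 0 := by
        by_contra h
        have := (hm'.1 a i h).2
        have := hT a
        omega
      rw [h1, h2]

lemma hq_add (x y : ℚ) : hq (x + y) = hq x * hq y := by
  unfold hq
  rw [HahnSeries.single_mul_single, one_mul]

lemma hq_zero : hq 0 = 1 := rfl

lemma hq_ne (x : ℚ) (hx : x ≠ 0) : (1 : K) - hq x ≠ 0 := by
  intro h
  have h2 : (1 : K) = hq x := sub_eq_zero.1 h
  have h3 := congrArg (fun f : K => f.coeff 0) h2
  unfold hq at h3
  simp only [HahnSeries.coeff_one, if_true] at h3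
  rw [HahnSeries.coeff_single_of_ne hx.symm] at h3
  exact one_ne_zero h3

lemma qbinE_shift (p : ℚ) (k : ℕ) :
    qbinE 1 (p - 1) (k + 1) = qbinE 1 p k * ((1 - hq p) / (1 - hq (k + 1))) := by
  unfold qbinE
  simp only [one_mul]
  rw [Finset.prod_div_distrib, Finset.prod_div_distrib, Finset.prod_range_succ',
    Finset.prod_range_succ (fun i : ℕ => (1 : K) - hq ((i : ℚ) + 1))]
  have e1 : ∀ i : ℕ, p - 1 + ((i + 1 : ℕ) : ℚ) + 1 = p + i + 1 := by
    intro i; push_cast; ring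
  have e2 : p - 1 + ((0 : ℕ) : ℚ) + 1 = p := by push_cast; ring
  simp only [e1, e2]
  rw [mul_div_mul_comm]

lemma qbinE_rec (p : ℚ) (k : ℕ) :
    qbinE 1 p (k + 1) = hq ((k + 1 : ℕ) : ℚ) * qbinE 1 (p - 1) (k + 1) + qbinE 1 p k := by
  rw [qbinE_shift]
  have h : qbinE 1 p (k + 1)
      = qbinE 1 p k * ((1 - hq p * hq (k + 1)) / (1 - hq (k + 1))) := by
    unfold qbinE
    rw [Finset.prod_range_succ, ← hq_add]
    simp only [one_mul, add_assoc]
  rw [h]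
  have hne := hq_ne ((k : ℚ) + 1) (by positivity)
  push_cast
  field_simp
  ring

lemma qbinT_rec (z : ℤ) (hz : 0 ≤ z) (k : ℕ) :
    qbinT 1 (z : ℚ) (k + 1)
      = hq ((k + 1 : ℕ) : ℚ) * qbinT 1 ((z : ℚ) - 1) (k + 1) + qbinT 1 (z : ℚ) k := by
  have hz' : (0 : ℚ) ≤ z := by exact_mod_cast hz
  unfold qbinT
  rw [if_pos hz', if_pos hz', qbinE_rec]
  congr 2
  split_ifs with h
  · rfl
  · have : z = 0 := by
      by_contra h0
      apply h
      have : (1 : ℤ) ≤ z := by omega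
      have : (1 : ℚ) ≤ z := by exact_mod_cast this
      linarith
    subst this
    rw [qbinE_shift]
    simp [hq_zero]

lemma qbinT_m_zero (p : ℚ) (hp : 0 ≤ p) : qbinT 1 p 0 = 1 := by
  unfold qbinT qbinE
  simp [hp]

lemma addOne_inj (a₀ : Fin n) (j₀ : ℕ) : Function.Injective (addOne a₀ j₀) := by
  intro m m' h
  funext a j
  have := congrFun (congrFun h a) j
  unfold addOne at this
  omega

/-- Splitting off the factor `(a₀,j₀)` in a product over `H_l`. -/
lemma prod_split (l : ℕ) (a₀ : Fin n) (j₀ : ℕ) (h1 : 1 ≤ j₀) (h2 : j₀ ≤ D.t a₀ * l)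
    (f : Fin n → ℕ → K) :
    ∏ a, ∏ i ∈ Finset.Icc 1 (D.t a * l), f a i
      = f a₀ j₀ * ∏ a, ∏ i ∈ Finset.Icc 1 (D.t a * l), (if a = a₀ ∧ i = j₀ then 1 else f a i) := by
  have hmem : j₀ ∈ Finset.Icc 1 (D.t a₀ * l) := Finset.mem_Icc.2 ⟨h1, h2⟩
  rw [← Finset.mul_prod_erase _ _ (Finset.mem_univ a₀),
    ← Finset.mul_prod_erase Finset.univ
      (fun a => ∏ i ∈ Finset.Icc 1 (D.t a * l), (if a = a₀ ∧ i = j₀ then 1 else f a i))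
      (Finset.mem_univ a₀),
    ← Finset.mul_prod_erase _ _ hmem,
    ← Finset.mul_prod_erase _ (fun i => if a₀ = a₀ ∧ i = j₀ then 1 else f a₀ i) hmem]
  rw [if_pos ⟨rfl, rfl⟩, one_mul, mul_assoc]
  congr 2
  · refine Finset.prod_congr rfl fun i hi => ?_
    rw [if_neg]
    rintro ⟨_, rfl⟩
    exact Finset.notMem_erase _ _ hi
  · refine Finset.prod_congr rfl fun a ha => Finset.prod_congr rfl fun i _ => ?_
    rw [if_neg]
    rintro ⟨rfl, _⟩
    exact Finset.notMem_erase _ _ ha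

/-- Theorem: recursion relation for the level-`l` restricted fermionic
form `M_l`. For `W` recorded by data `ν` supported in `H_l` and `W₁, W₂, W₃` as above,
assuming all indices occurring in `W₁, W₂, W₃` satisfy `j ≤ t_a l`, one has
`M_l(W₁,q) = M_l(W₂,q) + q^{−θ} M_l(W₃,q)` with
`θ = j₀ + Σ_{k=1}^{t_{a₀} l} ν^{(a₀)}_k min(j₀,k)`. -/
theorem statement1 (n : ℕ) (D : CartanDatum n) (l : ℕ) (hl : 1 ≤ l)
    (ν : Fin n → ℕ → ℕ) (hν : SuppIn D l ν)
    (a₀ : Fin n) (j₀ : ℕ) (hj₀ : 1 ≤ j₀)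
    (hb₁ : j₀ + 1 ≤ D.t a₀ * l)
    (hb₃ : ∀ b : Fin n, D.C a₀ b < 0 → ∀ k : ℕ, (k : ℤ) < -(D.C a₀ b) →
      ((((D.C b a₀) * (j₀ : ℤ) - (k : ℤ)).fdiv (D.C a₀ b)).toNat) ≤ D.t b * l) :
    Ml D 1 l (nu1 ν a₀ j₀)
      = Ml D 1 l (nu2 ν a₀ j₀)
        + hq (-((j₀ + ∑ k ∈ Finset.Icc 1 (D.t a₀ * l), ν a₀ k * min j₀ k : ℕ) : ℚ))
            * Ml D 1 l (nu3 D ν a₀ j₀) := by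
  have hj2 : j₀ ≤ D.t a₀ * l := by omega
  have hmem : j₀ ∈ Finset.Icc 1 (D.t a₀ * l) := Finset.mem_Icc.2 ⟨hj₀, hj2⟩
  set θ : ℚ := ((j₀ + ∑ k ∈ Finset.Icc 1 (D.t a₀ * l), ν a₀ k * min j₀ k : ℕ) : ℚ) with hθ
  -- vacancy numbers
  have hp2 : ∀ m a i, pl D l (nu2 ν a₀ j₀) m a i
      = pl D l (nu1 ν a₀ j₀) m a i - if a = a₀ ∧ i = j₀ then 1 else 0 := by
    intro m a i
    rw [pl_eq, pl_eq, PP_nu2 D l ν a₀ j₀ hj₀ hb₁]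
    ring
  have hp3 : ∀ m a i, pl D l (nu1 ν a₀ j₀) (addOne a₀ j₀ m) a i
      = pl D l (nu3 D ν a₀ j₀) m a i := by
    intro m a i
    rw [pl_eq, pl_eq, PP_nu3 D l ν a₀ j₀ hj₀ hj2 hb₃, LL_addOne D l a₀ j₀ hj₀ hj2]
    ring
  have hc2 : ∀ m, ConstrL D l (nu2 ν a₀ j₀) m 0 ↔ ConstrL D l (nu1 ν a₀ j₀) m 0 := by
    intro m
    unfold ConstrL
    refine forall_congr' fun b => ?_
    rw [wt_nu2 D l ν a₀ j₀ hj₀ hb₁]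
  have hc3 : ∀ m, ConstrL D l (nu1 ν a₀ j₀) (addOne a₀ j₀ m) 0
      ↔ ConstrL D l (nu3 D ν a₀ j₀) m 0 := by
    intro m
    unfold ConstrL
    refine forall_congr' fun b => ?_
    rw [wt_nu3 D l ν a₀ j₀ hj₀ hj2 hb₃]
    have e : ∀ m : Fin n → ℕ → ℕ,
        (∑ a, ∑ i ∈ Finset.Icc 1 (D.t a * l), (i : ℚ) * m a i * D.C b a)
        = ∑ a, ∑ i ∈ Finset.Icc 1 (D.t a * l), (m a i : ℚ) * (i * D.C b a) := fun m =>
      Finset.sum_congr rfl fun a _ => Finset.sum_congr rfl fun i _ => by ring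
    rw [e, e, sum_addOne D l a₀ j₀ hj₀ hj2 m (fun a i => (i : ℚ) * D.C b a)]
    simp only [Pi.zero_apply, sub_zero]
    constructor <;> intro h <;> linarith
  have hA2 : AA D l (nu2 ν a₀ j₀) ⊆ AA D l (nu1 ν a₀ j₀) := by
    rintro m ⟨hs, hc, hp⟩
    refine ⟨hs, (hc2 m).1 hc, fun a i hi => ?_⟩
    have := hp a i hi
    rw [hp2] at this
    split_ifs at this <;> linarith
  have hA3 : ∀ m, addOne a₀ j₀ m ∈ AA D l (nu1 ν a₀ j₀) ↔ m ∈ AA D l (nu3 D ν a₀ j₀) := by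
    intro m
    unfold AA
    simp only [Set.mem_ofPred_eq, hc3, hp3]
    refine and_congr_left fun _ => ?_
    unfold SuppIn addOne
    constructor
    · intro h a j hm
      exact h a j (by omega)
    · intro h a j hm
      by_cases hh : a = a₀ ∧ j = j₀
      · obtain ⟨rfl, rfl⟩ := hh
        exact ⟨hj₀, hj2⟩
      · rw [if_neg hh, add_zero] at hm
        exact h a j hm
  have hT3 : ∀ m, TT D l (nu3 D ν a₀ j₀) m = hq (cl D l (nu3 D ν a₀ j₀) m) *
      (qbinT 1 (pl D l (nu1 ν a₀ j₀) (addOne a₀ j₀ m) a₀ j₀) (m a₀ j₀) *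
      ∏ a, ∏ i ∈ Finset.Icc 1 (D.t a * l), (if a = a₀ ∧ i = j₀ then 1 else
        qbinT 1 (pl D l (nu1 ν a₀ j₀) (addOne a₀ j₀ m) a i) (addOne a₀ j₀ m a i))) := by
    intro m
    unfold TT
    rw [prod_split D l a₀ j₀ hj₀ hj2 (fun a i => qbinT 1 (pl D l (nu3 D ν a₀ j₀) m a i) (m a i))]
    simp only [hp3]
    congr 2
    refine Finset.prod_congr rfl fun a _ => Finset.prod_congr rfl fun i _ => ?_
    split_ifs with h
    · rfl
    · simp [addOne, h]
  have hT2 : ∀ m, TT D l (nu2 ν a₀ j₀) m = hq (cl D l (nu1 ν a₀ j₀) m) * hq (m a₀ j₀) *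
      (qbinT 1 (pl D l (nu1 ν a₀ j₀) m a₀ j₀ - 1) (m a₀ j₀) *
      ∏ a, ∏ i ∈ Finset.Icc 1 (D.t a * l), (if a = a₀ ∧ i = j₀ then 1 else
        qbinT 1 (pl D l (nu1 ν a₀ j₀) m a i) (m a i))) := by
    intro m
    unfold TT
    rw [prod_split D l a₀ j₀ hj₀ hj2 (fun a i => qbinT 1 (pl D l (nu2 ν a₀ j₀) m a i) (m a i)),
      cl_nu2 D l ν a₀ j₀ hj₀ hb₁, hq_add]
    simp only [hp2]
    congr 2
    · refine Finset.prod_congr rfl fun a _ => Finset.prod_congr rfl fun i _ => ?_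
      split_ifs with h
      · rfl
      · rw [sub_zero]
  have hT1 : ∀ m, TT D l (nu1 ν a₀ j₀) m = hq (cl D l (nu1 ν a₀ j₀) m) *
      (qbinT 1 (pl D l (nu1 ν a₀ j₀) m a₀ j₀) (m a₀ j₀) *
      ∏ a, ∏ i ∈ Finset.Icc 1 (D.t a * l), (if a = a₀ ∧ i = j₀ then 1 else
        qbinT 1 (pl D l (nu1 ν a₀ j₀) m a i) (m a i))) := by
    intro m
    unfold TT
    rw [prod_split D l a₀ j₀ hj₀ hj2 (fun a i => qbinT 1 (pl D l (nu1 ν a₀ j₀) m a i) (m a i))]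
  -- the two cases of the termwise recursion
  have hrec0 : ∀ m ∈ AA D l (nu1 ν a₀ j₀), m a₀ j₀ = 0 →
      TT D l (nu1 ν a₀ j₀) m = TT D l (nu2 ν a₀ j₀) m := by
    intro m hm h0
    have hpos := vac_pos D l ν a₀ j₀ hj₀ hb₁ m hm.2.2 h0
    rw [hT1, hT2, h0]
    obtain ⟨z, hz⟩ := pl_int D l (nu1 ν a₀ j₀) m a₀ j₀
    rw [hz] at hpos ⊢
    have hz1 : (0 : ℤ) < z := by exact_mod_cast hpos
    have hz2 : (1 : ℚ) ≤ z := by exact_mod_cast hz1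
    rw [qbinT_m_zero _ hpos.le, qbinT_m_zero _ (by linarith), Nat.cast_zero, hq_zero, mul_one]
  have hrec1 : ∀ m, addOne a₀ j₀ m ∈ AA D l (nu1 ν a₀ j₀) →
      TT D l (nu1 ν a₀ j₀) (addOne a₀ j₀ m)
        = TT D l (nu2 ν a₀ j₀) (addOne a₀ j₀ m) + hq (-θ) * TT D l (nu3 D ν a₀ j₀) m := by
    intro m hm
    rw [hT1, hT2, hT3]
    have hcl := cl_addOne D l ν a₀ j₀ hj₀ hj2 hb₃ m
    rw [← hθ] at hcl
    have hm1 : addOne a₀ j₀ m a₀ j₀ = m a₀ j₀ + 1 := by simp [addOne]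
    have hpos := hm.2.2 a₀ j₀ hmem
    obtain ⟨z, hz⟩ := pl_int D l (nu1 ν a₀ j₀) (addOne a₀ j₀ m) a₀ j₀
    rw [hz] at hpos ⊢
    have hz1 : (0 : ℤ) ≤ z := by exact_mod_cast hpos
    rw [hm1, qbinT_rec z hz1, hcl, hq_add]
    ring
  have hzero : ∀ m ∈ AA D l (nu1 ν a₀ j₀), m ∉ AA D l (nu2 ν a₀ j₀) →
      TT D l (nu2 ν a₀ j₀) m = 0 := by
    intro m hm hm2
    have : ∃ a, ∃ i ∈ Finset.Icc 1 (D.t a * l), pl D l (nu2 ν a₀ j₀) m a i < 0 := by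
      by_contra hcon
      push Not at hcon
      exact hm2 ⟨hm.1, (hc2 m).2 hm.2.1, hcon⟩
    obtain ⟨a, i, hi, hneg⟩ := this
    unfold TT
    have hz : qbinT 1 (pl D l (nu2 ν a₀ j₀) m a i) (m a i) = 0 := by
      unfold qbinT
      rw [if_neg (not_le.2 hneg)]
    rw [Finset.prod_eq_zero (Finset.mem_univ a) (Finset.prod_eq_zero hi hz), mul_zero]
  rw [Ml_eq, Ml_eq, Ml_eq, finsum_mem_eq_finite_toFinset_sum _ (AA_finite D l (nu1 ν a₀ j₀)),
    finsum_mem_eq_finite_toFinset_sum _ (AA_finite D l (nu2 ν a₀ j₀)),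
    finsum_mem_eq_finite_toFinset_sum _ (AA_finite D l (nu3 D ν a₀ j₀))]
  set S1 := (AA_finite D l (nu1 ν a₀ j₀)).toFinset with hS1
  set S2 := (AA_finite D l (nu2 ν a₀ j₀)).toFinset with hS2
  set S3 := (AA_finite D l (nu3 D ν a₀ j₀)).toFinset with hS3
  have h2 : ∑ m ∈ S2, TT D l (nu2 ν a₀ j₀) m = ∑ m ∈ S1, TT D l (nu2 ν a₀ j₀) m := by
    apply Finset.sum_subset
    · intro m hm
      rw [hS2, Set.Finite.mem_toFinset] at hm
      rw [hS1, Set.Finite.mem_toFinset]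
      exact hA2 hm
    · intro m hm hm2
      rw [hS2, Set.Finite.mem_toFinset] at hm2
      rw [hS1, Set.Finite.mem_toFinset] at hm
      exact hzero m hm hm2
  have h3 : hq (-θ) * ∑ m ∈ S3, TT D l (nu3 D ν a₀ j₀) m
      = ∑ m ∈ S1, (TT D l (nu1 ν a₀ j₀) m - TT D l (nu2 ν a₀ j₀) m) := by
    rw [Finset.mul_sum]
    apply Finset.sum_of_injOn (addOne a₀ j₀) ((addOne_inj a₀ j₀).injOn)
    · intro m hm
      rw [Finset.mem_coe, hS3, Set.Finite.mem_toFinset] at hm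
      rw [Finset.mem_coe, hS1, Set.Finite.mem_toFinset]
      exact (hA3 m).2 hm
    · intro m hm hm2
      rw [hS1, Set.Finite.mem_toFinset] at hm
      rw [hrec0 m hm, sub_self]
      by_contra h0
      apply hm2
      have he : addOne a₀ j₀ (fun a j => m a j - if a = a₀ ∧ j = j₀ then 1 else 0) = m := by
        funext a j
        unfold addOne
        by_cases hh : a = a₀ ∧ j = j₀
        · obtain ⟨rfl, rfl⟩ := hh
          simp only [and_self, if_true]
          omega
        · simp [hh]
      refine ⟨_, ?_, he⟩
      rw [Finset.mem_coe, hS3, Set.Finite.mem_toFinset, ← hA3, he]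
      exact hm
    · intro m hm
      rw [hS3, Set.Finite.mem_toFinset] at hm
      rw [hrec1 m ((hA3 m).2 hm)]
      ring
  rw [h2, h3, Finset.sum_sub_distrib]
  ring

end FermionicPaper
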